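/- arXiv:1803.11411 — 7 statements merged into one kernel-verified Lean document; each statement's English description precedes it below -/
import Mathlib

section
/- Let n, m ≥ 1 and let A = [a_{ij}] be the (n+m)×(n+m) nonnegative weighted adjacency matrix of a directed graph (a_{ij} ≥ 0, a_{ii} = 0), in which the last m nodes (the leaders) have no neighbors, i.e., a_{ij} = 0 whenever i > n. Let L be the associated Laplacian matrix (ℓ_{ii} = Σ_j a_{ij} and ℓ_{ij} = −a_{ij} for i ≠ j) and partition L = [[L₁, L₂],[0, 0]] with L₁ ∈ ℝ^{n×n} and L₂ ∈ ℝ^{n×m}. Assume the graph is acyclic, i.e., (A^k)_{ii} = 0 for every k ≥ 1 and every node i, and that for each follower i ≤ n there exist k ≥ 1 and a leader j > n with (A^k)_{ij} > 0 (i.e., there is a directed path from some leader to each follower). Then L₁ is invertible, every complex eigenvalue of L₁ has positive real part, every entry of −L₁⁻¹L₂ is nonnegative, and every row of −L₁⁻¹L₂ sums to 1. -/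
open Matrix

/-- A set of indices closed under the positive entries of a matrix is closed under the positive
entries of its powers. -/
theorem Matrix.mem_of_pow_pos {ι : Type*} [Fintype ι] [DecidableEq ι] {A : Matrix ι ι ℝ}
    (hA : ∀ i j, 0 ≤ A i j) {S : Set ι} (hS : ∀ i j, i ∈ S → 0 < A i j → j ∈ S) (k : ℕ) :
    ∀ i j, i ∈ S → 0 < (A ^ k) i j → j ∈ S := by
  induction k with
  | zero =>
    intro i j hi h
    by_cases hij : i = j
    · exact hij ▸ hi
    · simp [hij] at h
  | succ k ih =>
    intro i j hi h
    rw [pow_succ, Matrix.mul_apply] at h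
    obtain ⟨l, -, hl⟩ := Finset.exists_lt_of_sum_lt (f := fun _ => (0 : ℝ)) (by simpa using h)
    refine hS l j (ih i l hi ?_) ((hA l j).lt_of_ne' (right_ne_zero_of_mul hl.ne'))
    exact pos_of_mul_pos_left hl (hA l j)

/-- Minimum principle: a function vanishing on the leaders and superharmonic on the followers is
nonnegative, provided every follower is joined to a leader. -/
theorem Matrix.nonneg_of_superharmonic {α β : Type*} [Fintype α] [Fintype β] [DecidableEq α]
    [DecidableEq β] {A : Matrix (α ⊕ β) (α ⊕ β) ℝ} (hA : ∀ i j, 0 ≤ A i j)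
    (hreach : ∀ i : α, ∃ k : ℕ, ∃ j : β, 0 < (A ^ k) (Sum.inl i) (Sum.inr j))
    {y : α ⊕ β → ℝ} (hβ : ∀ j, y (Sum.inr j) = 0)
    (hy : ∀ i : α, 0 ≤ ∑ l, A (Sum.inl i) l * (y (Sum.inl i) - y l)) (i : α) :
    0 ≤ y (Sum.inl i) := by
  obtain ⟨p, -, hp⟩ := Finset.exists_min_image Finset.univ y ⟨Sum.inl i, Finset.mem_univ _⟩
  replace hp : ∀ l, y p ≤ y l := fun l => hp l (Finset.mem_univ l)
  by_contra! hi
  have hneg : y p < 0 := (hp _).trans_lt hi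
  rcases p with p | p
  swap
  · exact hneg.ne (hβ p)
  obtain ⟨k, j, hkj⟩ := hreach p
  have key := Matrix.mem_of_pow_pos hA (S := {q | y q = y (Sum.inl p)}) ?_ k _ _ rfl hkj
  · exact hneg.ne (key.symm.trans (hβ j))
  rintro (q | q) l hq hql
  · have hq' : y (Sum.inl q) = y (Sum.inl p) := hq
    have hle : ∀ r ∈ Finset.univ, A (Sum.inl q) r * (y (Sum.inl q) - y r) ≤ 0 := fun r _ =>
      mul_nonpos_of_nonneg_of_nonpos (hA _ _) (by linarith [hp r])
    have hsum := le_antisymm (Finset.sum_nonpos hle) (hy q)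
    have h0 := (Finset.sum_eq_zero_iff_of_nonpos hle).1 hsum l (Finset.mem_univ l)
    have := (mul_eq_zero.1 h0).resolve_left hql.ne'
    change y l = y (Sum.inl p)
    linarith
  · have hq' : y (Sum.inr q) = y (Sum.inl p) := hq
    exact absurd (hq'.symm.trans (hβ q)) hneg.ne

/-- By Gershgorin's theorem, an eigenvalue of a nonsingular matrix that is weakly row diagonally
dominant with nonnegative real diagonal has positive real part. -/
theorem Matrix.re_pos_of_isRoot_charpoly {ι : Type*} [Fintype ι] [DecidableEq ι]
    {M : Matrix ι ι ℝ} (hdet : M.det ≠ 0)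
    (hM : ∀ i, ∑ j ∈ Finset.univ.erase i, |M i j| ≤ M i i) {μ : ℂ}
    (hμ : (M.map Complex.ofReal).charpoly.IsRoot μ) : 0 < μ.re := by
  have hne : μ ≠ 0 := by
    rintro rfl
    rw [Polynomial.IsRoot, Matrix.eval_charpoly] at hμ
    have hdet' : (M.map Complex.ofReal).det = (M.det : ℂ) := (Complex.ofRealHom.map_det M).symm
    simp [Matrix.det_neg, hdet', hdet] at hμ
  have hev : Module.End.HasEigenvalue (Matrix.toLin' (M.map Complex.ofReal)) μ := by
    rw [Module.End.hasEigenvalue_iff_isRoot_charpoly, Matrix.charpoly_toLin']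
    exact hμ
  obtain ⟨i, hi⟩ := eigenvalue_mem_ball hev
  rw [mem_closedBall_iff_norm] at hi
  simp only [Matrix.map_apply, Complex.norm_real, Real.norm_eq_abs] at hi
  have hd : 0 ≤ M i i := (Finset.sum_nonneg fun _ _ => abs_nonneg _).trans (hM i)
  have hsq := pow_le_pow_left₀ (norm_nonneg _) (hi.trans (hM i)) 2
  rw [Complex.sq_norm, Complex.normSq_apply] at hsq
  simp only [Complex.sub_re, Complex.sub_im, Complex.ofReal_re, Complex.ofReal_im, sub_zero] at hsq
  have hpos := Complex.normSq_pos.2 hne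
  rw [Complex.normSq_apply] at hpos
  by_contra! hre
  nlinarith [mul_nonneg hd (neg_nonneg.2 hre)]

/-- **Lemma 1 (Meng et al.).** For an acyclic directed graph on `n` followers and `m`
leaders, in which leaders have no neighbors and each follower is reachable from some
leader, the follower block `L₁` of the Laplacian is invertible, all its complex
eigenvalues have positive real part, every entry of `-L₁⁻¹ * L₂` is nonnegative, and
every row of `-L₁⁻¹ * L₂` sums to one. -/
theorem laplacian_follower_block_properties (n m : ℕ) (hn : 1 ≤ n) (hm : 1 ≤ m)
    (A : Matrix (Fin n ⊕ Fin m) (Fin n ⊕ Fin m) ℝ)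
    (hnonneg : ∀ i j, 0 ≤ A i j)
    (hdiag : ∀ i, A i i = 0)
    (hleaders : ∀ (k : Fin m) (j : Fin n ⊕ Fin m), A (Sum.inr k) j = 0)
    (hacyclic : ∀ k : ℕ, 1 ≤ k → ∀ i, (A ^ k) i i = 0)
    (hreach : ∀ i : Fin n, ∃ k : ℕ, 1 ≤ k ∧ ∃ j : Fin m,
      0 < (A ^ k) (Sum.inl i) (Sum.inr j))
    (L : Matrix (Fin n ⊕ Fin m) (Fin n ⊕ Fin m) ℝ)
    (hL : ∀ i j, L i j = if i = j then ∑ l, A i l else -A i j)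
    (L₁ : Matrix (Fin n) (Fin n) ℝ) (hL₁ : L₁ = L.submatrix Sum.inl Sum.inl)
    (L₂ : Matrix (Fin n) (Fin m) ℝ) (hL₂ : L₂ = L.submatrix Sum.inl Sum.inr) :
    IsUnit L₁.det ∧
    (∀ μ : ℂ, (L₁.map Complex.ofReal).charpoly.IsRoot μ → 0 < μ.re) ∧
    (∀ i j, 0 ≤ (-(L₁⁻¹ * L₂)) i j) ∧
    (∀ i, ∑ j, (-(L₁⁻¹ * L₂)) i j = 1) := by
  have hL₁ii (i) : L₁ i i = ∑ l, A (Sum.inl i) l := by simp [hL₁, hL]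
  have hL₁ij (i j) (h : i ≠ j) : L₁ i j = -A (Sum.inl i) (Sum.inl j) := by simp [hL₁, hL, h]
  have hL₂ij (i j) : L₂ i j = -A (Sum.inl i) (Sum.inr j) := by simp [hL₂, hL]
  have hL₁d (i j) : L₁ i j =
      (if i = j then ∑ l, A (Sum.inl i) l else 0) - A (Sum.inl i) (Sum.inl j) := by
    by_cases h : i = j
    · subst h
      simp [hL₁ii, hdiag]
    · simp [hL₁ij i j h, h]
  have hmulVec (x : Fin n → ℝ) (i) : (L₁ *ᵥ x) i =
      ∑ l, A (Sum.inl i) l * (x i - Sum.elim x (fun _ => 0) l) := by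
    simp only [Matrix.mulVec, dotProduct, hL₁d, sub_mul, mul_sub, Finset.sum_sub_distrib,
      ite_mul, zero_mul, Finset.sum_ite_eq, Finset.mem_univ, if_true, Finset.sum_mul]
    simp
  have hmin (x : Fin n → ℝ) (hx : ∀ i, 0 ≤ (L₁ *ᵥ x) i) (i) : 0 ≤ x i := by
    refine Matrix.nonneg_of_superharmonic (y := Sum.elim x fun _ => 0) hnonneg
      (fun i => ?_) (fun _ => rfl) (fun i => ?_) i
    · obtain ⟨k, -, j, h⟩ := hreach i
      exact ⟨k, j, h⟩
    · simpa [hmulVec] using hx i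
  have hdet : L₁.det ≠ 0 := by
    intro h
    obtain ⟨v, hv, hv0⟩ := Matrix.exists_mulVec_eq_zero_iff.2 h
    refine hv (funext fun i => le_antisymm ?_ (hmin v (by simp [hv0]) i))
    simpa using hmin (-v) (by simp [Matrix.mulVec_neg, hv0]) i
  have hunit : IsUnit L₁.det := hdet.isUnit
  refine ⟨hunit, fun μ hμ => Matrix.re_pos_of_isRoot_charpoly hdet (fun i => ?_) hμ,
    fun i j => ?_, fun i => ?_⟩
  · rw [hL₁ii, Fintype.sum_sum_type]
    calc ∑ j ∈ Finset.univ.erase i, |L₁ i j|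
        = ∑ j ∈ Finset.univ.erase i, A (Sum.inl i) (Sum.inl j) := by
          refine Finset.sum_congr rfl fun j hj => ?_
          rw [hL₁ij i j (Finset.ne_of_mem_erase hj).symm, abs_neg, abs_of_nonneg (hnonneg _ _)]
      _ ≤ ∑ j, A (Sum.inl i) (Sum.inl j) :=
          Finset.sum_le_sum_of_subset_of_nonneg (Finset.erase_subset _ _)
            fun _ _ _ => hnonneg _ _
      _ ≤ _ := le_add_of_nonneg_right (Finset.sum_nonneg fun _ _ => hnonneg _ _)
  · refine hmin (fun i => (-(L₁⁻¹ * L₂)) i j) (fun i => ?_) i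
    have : (L₁ * -(L₁⁻¹ * L₂)) i j = A (Sum.inl i) (Sum.inr j) := by
      rw [Matrix.mul_neg, Matrix.mul_nonsing_inv_cancel_left _ _ hunit, Matrix.neg_apply, hL₂ij,
        neg_neg]
    exact (hnonneg (Sum.inl i) (Sum.inr j)).trans_eq this.symm
  · have hone : L₁ *ᵥ 1 = -(L₂ *ᵥ 1) := by
      funext i
      rw [hmulVec]
      simp [Matrix.mulVec, dotProduct, hL₂ij]
    have : (-(L₁⁻¹ * L₂)) *ᵥ 1 = 1 := by
      rw [Matrix.neg_mulVec, ← Matrix.mulVec_mulVec, ← Matrix.mulVec_neg, ← hone,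
        Matrix.mulVec_mulVec, Matrix.nonsing_inv_mul _ hunit, Matrix.one_mulVec]
    simpa [Matrix.mulVec, dotProduct] using congrFun this i
end

section
/- Let A ∈ ℝ^{N×N}, C ∈ ℝ^{q×N}, and let E ∈ ℝ^{N×N} and R ∈ ℝ^{q×q} be symmetric positive definite matrices. Suppose Φ ∈ ℝ^{N×N} is symmetric positive definite and satisfies the observer algebraic Riccati equation AΦ + ΦAᵀ + E − ΦCᵀR⁻¹CΦ = 0, and set F = ΦCᵀR⁻¹. Let λ ∈ ℂ have positive real part and let μ ∈ ℝ satisfy μ ≥ 1/(2·Re(λ)). Then the complex matrix A − μλFC (with A, F, C regarded as complex matrices) is Hurwitz. -/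
open Matrix

/-- A complex square matrix is Hurwitz if every complex eigenvalue (root of its
characteristic polynomial) has negative real part. -/
def IsHurwitz {n : Type*} [Fintype n] [DecidableEq n] (M : Matrix n n ℂ) : Prop :=
  ∀ μ : ℂ, M.charpoly.IsRoot μ → μ.re < 0

open scoped MatrixOrder ComplexOrder

theorem Matrix.PosSemidef.map_ofReal {n : Type*} [Fintype n] {P : Matrix n n ℝ}
    (hP : P.PosSemidef) : (P.map Complex.ofReal).PosSemidef := by
  classical
  obtain ⟨B, rfl⟩ := CStarAlgebra.nonneg_iff_eq_star_mul_self.mp hP.nonneg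
  have h : (star B * B).map Complex.ofReal =
      (B.map Complex.ofReal)ᴴ * B.map Complex.ofReal := by
    ext i j
    simp [Matrix.mul_apply]
  rw [h]
  exact posSemidef_conjTranspose_mul_self _

theorem Matrix.PosDef.map_ofReal {n : Type*} [Fintype n] {P : Matrix n n ℝ}
    (hP : P.PosDef) : (P.map Complex.ofReal).PosDef := by
  classical
  exact hP.posSemidef.map_ofReal.posDef_iff_isUnit.mpr
    (hP.isUnit.map (Complex.ofRealHom.mapMatrix (m := n)))

/-- **Lyapunov's criterion.** If `P` and `Q` are positive definite and `MP + PMᴴ = -Q`, then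
`M` is Hurwitz. -/
theorem IsHurwitz.of_lyapunov {n : Type*} [Fintype n] [DecidableEq n] {M P Q : Matrix n n ℂ}
    (hP : P.PosDef) (hQ : Q.PosDef) (h : M * P + P * Mᴴ = -Q) : IsHurwitz M := by
  intro s hs
  rw [Polynomial.IsRoot.def, eval_charpoly, ← exists_vecMul_eq_zero_iff] at hs
  obtain ⟨v, hv, hvM⟩ := hs
  have hvs : v ᵥ* M = s • v := by
    rw [vecMul_sub, sub_eq_zero] at hvM
    rw [← hvM, scalar_apply, ← smul_one_eq_diagonal, vecMul_smul, vecMul_one]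
  have hsv : Mᴴ *ᵥ star v = star s • star v := by
    rw [← star_vecMul, hvs, star_smul]
  have hp := hP.dotProduct_mulVec_pos (star_ne_zero.mpr hv)
  have hq := hQ.dotProduct_mulVec_pos (star_ne_zero.mpr hv)
  rw [star_star] at hp hq
  have key : (s + star s) * (v ⬝ᵥ P *ᵥ star v) = -(v ⬝ᵥ Q *ᵥ star v) := by
    rw [← dotProduct_neg, ← neg_mulVec, ← h, add_mulVec, dotProduct_add, ← mulVec_mulVec,
      ← mulVec_mulVec, hsv, dotProduct_mulVec v M, hvs, mulVec_smul, dotProduct_smul,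
      smul_dotProduct, smul_eq_mul, smul_eq_mul, add_mul]
  rw [Complex.pos_iff] at hp hq
  have hre := congrArg Complex.re key
  simp only [Complex.star_def, Complex.mul_re, Complex.add_re, Complex.add_im, Complex.conj_re,
    Complex.conj_im, Complex.neg_re] at hre
  nlinarith [hp.1, hq.1]

/-- **Lemma 2 (per-eigenvalue claim).** If `Φ` is the symmetric positive definite solution
of the observer algebraic Riccati equation `AΦ + ΦAᵀ + E − ΦCᵀR⁻¹CΦ = 0` and
`F = ΦCᵀR⁻¹`, then for any complex `λ` with positive real part and any real coupling gain
`μ ≥ 1/(2 Re λ)`, the complex matrix `A − μ λ F C` is Hurwitz. -/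
theorem observer_riccati_gain_hurwitz (N q : ℕ)
    (A : Matrix (Fin N) (Fin N) ℝ) (C : Matrix (Fin q) (Fin N) ℝ)
    (E : Matrix (Fin N) (Fin N) ℝ) (R : Matrix (Fin q) (Fin q) ℝ)
    (hE : E.PosDef) (hR : R.PosDef)
    (Φ : Matrix (Fin N) (Fin N) ℝ) (hΦ : Φ.PosDef)
    (hRic : A * Φ + Φ * Aᵀ + E - Φ * Cᵀ * R⁻¹ * C * Φ = 0)
    (F : Matrix (Fin N) (Fin q) ℝ) (hF : F = Φ * Cᵀ * R⁻¹)
    (lam : ℂ) (hlam : 0 < lam.re)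
    (μ : ℝ) (hμ : 1 / (2 * lam.re) ≤ μ) :
    IsHurwitz (A.map Complex.ofReal -
      (μ : ℂ) • lam • (F.map Complex.ofReal * C.map Complex.ofReal)) := by
  set G := Φ * Cᵀ * R⁻¹ * C * Φ with hG
  have hΦt : Φᵀ = Φ := by simpa using hΦ.isHermitian.eq
  have hGpos : G.PosSemidef := by
    have := hR.inv.posSemidef.conjTranspose_mul_mul_same (C * Φ)
    rwa [conjTranspose_eq_transpose_of_trivial, transpose_mul, hΦt, ← Matrix.mul_assoc] at this
  have hc : 0 ≤ 2 * μ * lam.re - 1 := by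
    rw [div_le_iff₀ (by positivity)] at hμ
    linarith
  have hQ : (E + (2 * μ * lam.re - 1) • G).PosDef := hE.add_posSemidef (hGpos.smul hc)
  refine IsHurwitz.of_lyapunov hΦ.map_ofReal hQ.map_ofReal ?_
  set M := A.map Complex.ofReal - (μ : ℂ) • lam • (F.map Complex.ofReal * C.map Complex.ofReal)
    with hM
  have hMΦ : M * Φ.map Complex.ofReal =
      (A * Φ).map Complex.ofReal - ((μ : ℂ) * lam) • G.map Complex.ofReal := by
    have hmul {k l m : ℕ} (X : Matrix (Fin k) (Fin l) ℝ) (Y : Matrix (Fin l) (Fin m) ℝ) :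
        (X * Y).map Complex.ofReal = X.map Complex.ofReal * Y.map Complex.ofReal :=
      Matrix.map_mul (f := Complex.ofRealHom)
    rw [hM, hG, ← hF, hmul, hmul (F * C), hmul F, sub_mul, smul_smul, smul_mul_assoc]
  have hΦM : Φ.map Complex.ofReal * Mᴴ = (M * Φ.map Complex.ofReal)ᴴ := by
    rw [conjTranspose_mul, hΦ.map_ofReal.isHermitian.eq]
  rw [hΦM, hMΦ]
  ext i j
  have hij := congrFun (congrFun hRic i) j
  have hGij : G j i = G i j := by simpa using hGpos.isHermitian.apply i j
  have hAt : (Φ * Aᵀ) i j = (A * Φ) j i := by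
    rw [← transpose_apply (A * Φ), transpose_mul, hΦt]
  simp only [Matrix.add_apply, Matrix.sub_apply, Matrix.zero_apply, hAt] at hij
  apply Complex.ext
  · simp [hGij]
    linarith
  · simp [hGij]
end

section
/- Let n, m, N, q, q̄ ≥ 1, let L₁ ∈ ℝ^{n×n} be invertible, L₂ ∈ ℝ^{n×m}, A ∈ ℝ^{N×N}, G₁ ∈ ℝ^{N×N}, G₂ ∈ ℝ^{N×nq̄}, C̄ ∈ ℝ^{nq×N}, H ∈ ℝ^{N×nq}, S ∈ ℝ^{q̄×q̄}, D ∈ ℝ^{q×q̄}, Π ∈ ℝ^{N×nq̄}, and β ∈ ℝ. Assume (A + G₁)Π + G₂ = Π(I_n ⊗ S) and C̄Π = I_n ⊗ D. Define A_c = [[A, G₁, G₂],[HC̄, A + G₁ − HC̄, G₂],[0, 0, (I_n⊗S) − β(L₁⊗I_{q̄})]], B_c = [0; 0; −β(L₂⊗I_{q̄})], C_c = [(L₁⊗I_q)C̄, 0, 0], D_c = L₂ ⊗ D, S̄ = I_m ⊗ S, and X_c = [−Π(L₁⁻¹L₂ ⊗ I_{q̄}); −Π(L₁⁻¹L₂ ⊗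 I_{q̄}); −(L₁⁻¹L₂ ⊗ I_{q̄})]. Then X_c solves the regulator equations: A_cX_c + B_c = X_cS̄ and C_cX_c + D_c = 0. -/
open Matrix
open scoped Kronecker

/-- **Solution of the regulator equations (proof of Theorem 1).** Under the per-follower
output regulator equations, packed as `(A + G₁)Π + G₂ = Π(Iₙ ⊗ S)` and `C̄Π = Iₙ ⊗ D`,
the matrix `X_c = [−Π(L₁⁻¹L₂ ⊗ I); −Π(L₁⁻¹L₂ ⊗ I); −(L₁⁻¹L₂ ⊗ I)]` solves the regulator
equations `A_cX_c + B_c = X_cS̄` and `C_cX_c + D_c = 0` of the closed-loop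
containment-control system. -/
theorem closed_loop_regulator_equations_solution
    (n m N q qb : ℕ) (hn : 1 ≤ n) (hm : 1 ≤ m) (hN : 1 ≤ N) (hq : 1 ≤ q) (hqb : 1 ≤ qb)
    (L₁ : Matrix (Fin n) (Fin n) ℝ) (hL₁ : IsUnit L₁.det)
    (L₂ : Matrix (Fin n) (Fin m) ℝ)
    (A G₁ : Matrix (Fin N) (Fin N) ℝ)
    (G₂ : Matrix (Fin N) (Fin n × Fin qb) ℝ)
    (Cb : Matrix (Fin n × Fin q) (Fin N) ℝ)
    (H : Matrix (Fin N) (Fin n × Fin q) ℝ)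
    (S : Matrix (Fin qb) (Fin qb) ℝ)
    (D : Matrix (Fin q) (Fin qb) ℝ)
    (Pmat : Matrix (Fin N) (Fin n × Fin qb) ℝ)
    (β : ℝ)
    (hreg1 : (A + G₁) * Pmat + G₂ = Pmat * ((1 : Matrix (Fin n) (Fin n) ℝ) ⊗ₖ S))
    (hreg2 : Cb * Pmat = (1 : Matrix (Fin n) (Fin n) ℝ) ⊗ₖ D)
    (Ac : Matrix ((Fin N ⊕ Fin N) ⊕ (Fin n × Fin qb))
      ((Fin N ⊕ Fin N) ⊕ (Fin n × Fin qb)) ℝ)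
    (hAc : Ac = Matrix.fromBlocks
      (Matrix.fromBlocks A G₁ (H * Cb) (A + G₁ - H * Cb))
      (Matrix.of fun i j => match i with
        | Sum.inl a => G₂ a j
        | Sum.inr a => G₂ a j)
      0
      (((1 : Matrix (Fin n) (Fin n) ℝ) ⊗ₖ S) -
        β • (L₁ ⊗ₖ (1 : Matrix (Fin qb) (Fin qb) ℝ))))
    (Bc : Matrix ((Fin N ⊕ Fin N) ⊕ (Fin n × Fin qb)) (Fin m × Fin qb) ℝ)
    (hBc : Bc = Matrix.of fun i j => match i with
      | Sum.inl _ => 0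
      | Sum.inr a => (-(β • (L₂ ⊗ₖ (1 : Matrix (Fin qb) (Fin qb) ℝ)))) a j)
    (Cc : Matrix (Fin n × Fin q) ((Fin N ⊕ Fin N) ⊕ (Fin n × Fin qb)) ℝ)
    (hCc : Cc = Matrix.of fun i j => match j with
      | Sum.inl (Sum.inl b) => (((L₁ ⊗ₖ (1 : Matrix (Fin q) (Fin q) ℝ)) * Cb)) i b
      | _ => 0)
    (Dc : Matrix (Fin n × Fin q) (Fin m × Fin qb) ℝ)
    (hDc : Dc = L₂ ⊗ₖ D)
    (Sbar : Matrix (Fin m × Fin qb) (Fin m × Fin qb) ℝ)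
    (hSbar : Sbar = (1 : Matrix (Fin m) (Fin m) ℝ) ⊗ₖ S)
    (Xc : Matrix ((Fin N ⊕ Fin N) ⊕ (Fin n × Fin qb)) (Fin m × Fin qb) ℝ)
    (hXc : Xc = Matrix.of fun i j => match i with
      | Sum.inl (Sum.inl a) =>
          (-(Pmat * ((L₁⁻¹ * L₂) ⊗ₖ (1 : Matrix (Fin qb) (Fin qb) ℝ)))) a j
      | Sum.inl (Sum.inr a) =>
          (-(Pmat * ((L₁⁻¹ * L₂) ⊗ₖ (1 : Matrix (Fin qb) (Fin qb) ℝ)))) a j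
      | Sum.inr a =>
          (-((L₁⁻¹ * L₂) ⊗ₖ (1 : Matrix (Fin qb) (Fin qb) ℝ))) a j) :
    Ac * Xc + Bc = Xc * Sbar ∧ Cc * Xc + Dc = 0 := by
  set M := (L₁⁻¹ * L₂) ⊗ₖ (1 : Matrix (Fin qb) (Fin qb) ℝ) with hM
  have hX : Xc = fromRows (fromRows (-(Pmat * M)) (-(Pmat * M))) (-M) := by
    rw [hXc]; ext (_ | _) j
    · rename_i a; rcases a with a | a <;> rfl
    · rfl
  have hB : Bc = fromRows (fromRows 0 0)
      (-(β • (L₂ ⊗ₖ (1 : Matrix (Fin qb) (Fin qb) ℝ)))) := by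
    rw [hBc]; ext (_ | _) j
    · rename_i a; rcases a with a | a <;> rfl
    · rfl
  have hC : Cc = fromCols (fromCols ((L₁ ⊗ₖ (1 : Matrix (Fin q) (Fin q) ℝ)) * Cb) 0) 0 := by
    rw [hCc]; ext i (_ | _)
    · rename_i a; rcases a with a | a <;> rfl
    · rfl
  have hA : Ac = fromBlocks
      (fromBlocks A G₁ (H * Cb) (A + G₁ - H * Cb)) (fromRows G₂ G₂) 0
      (((1 : Matrix (Fin n) (Fin n) ℝ) ⊗ₖ S) -
        β • (L₁ ⊗ₖ (1 : Matrix (Fin qb) (Fin qb) ℝ))) := by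
    rw [hAc]; congr 1; ext (_ | _) j <;> rfl
  have hL : L₁ * (L₁⁻¹ * L₂) = L₂ := Matrix.mul_nonsing_inv_cancel_left _ _ hL₁
  have hcomm : ((1 : Matrix (Fin n) (Fin n) ℝ) ⊗ₖ S) * M = M * Sbar := by
    rw [hSbar, hM, ← mul_kronecker_mul, ← mul_kronecker_mul]
    simp only [Matrix.one_mul, Matrix.mul_one]
  have hLM : (L₁ ⊗ₖ (1 : Matrix (Fin qb) (Fin qb) ℝ)) * M =
      L₂ ⊗ₖ (1 : Matrix (Fin qb) (Fin qb) ℝ) := by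
    rw [hM, ← mul_kronecker_mul, hL, Matrix.one_mul]
  have hstate : A * (Pmat * M) + G₁ * (Pmat * M) + G₂ * M = Pmat * M * Sbar := by
    rw [Matrix.mul_assoc Pmat M, ← hcomm, ← Matrix.mul_assoc Pmat, ← hreg1]
    simp only [Matrix.add_mul, Matrix.mul_assoc]
  have hout : (L₁ ⊗ₖ (1 : Matrix (Fin q) (Fin q) ℝ)) * Cb * (Pmat * M) = L₂ ⊗ₖ D := by
    rw [Matrix.mul_assoc, ← Matrix.mul_assoc Cb, hreg2, hM, ← mul_kronecker_mul,
      ← mul_kronecker_mul]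
    simp only [Matrix.one_mul, Matrix.mul_one, hL]
  have hadd {r₁ r₂ c : Type} (a b : Matrix r₁ c ℝ) (a' b' : Matrix r₂ c ℝ) :
      fromRows a a' + fromRows b b' = fromRows (a + b) (a' + b') := by
    ext (_ | _) j <;> rfl
  constructor
  · rw [hA, hX, hB]
    simp only [fromBlocks_mul_fromRows, fromRows_mul, hadd]
    congr 1
    · congr 1
      · rw [Matrix.neg_mul, ← hstate]
        simp only [Matrix.mul_neg]
        abel
      · rw [Matrix.neg_mul, ← hstate]
        simp only [Matrix.mul_neg, Matrix.sub_mul, Matrix.add_mul]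
        abel
    · rw [Matrix.neg_mul, ← hcomm, ← hLM]
      simp only [Matrix.mul_neg, Matrix.sub_mul, Matrix.zero_mul, Matrix.smul_mul]
      abel
  · rw [hC, hX, hDc, ← hout]
    simp only [fromCols_mul_fromRows, Matrix.zero_mul, Matrix.mul_neg]
    abel
end

section
/- Let S ∈ ℝ^{q̄×q̄} be a matrix every complex eigenvalue of which has nonpositive real part, let L₁ ∈ ℝ^{n×n} be a matrix every complex eigenvalue of which has positive real part, and let β₂ > 0. Let S̃_d : ℝ → ℝ^{nq̄×nq̄} be continuous and decay to zero exponentially, and let ω* : ℝ → ℝ^{nq̄} be continuous and bounded. Then every differentiable function η̃ : ℝ → ℝ^{nq̄} satisfying η̃'(t) = ((I_n ⊗ S) − β₂(L₁ ⊗ I_{q̄}))η̃(t) + S̃_d(t)η̃(t) + S̃_d(t)ω*(t) for all t ≥ 0 decays to zero exponentially. -/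
open Matrix
open scoped Kronecker

/-- A function on `[0, ∞)` is bounded by a multiple of `e^{ρ t}`. -/
def ExpBounded {E : Type*} [Norm E] (ρ : ℝ) (f : ℝ → E) : Prop :=
  ∃ c : ℝ, ∀ t : ℝ, 0 ≤ t → ‖f t‖ ≤ c * Real.exp (ρ * t)

namespace ExpBounded

variable {E F : Type*} [NormedAddCommGroup E] [NormedAddCommGroup F]

theorem mono {ρ σ : ℝ} {f : ℝ → E} (hf : ExpBounded ρ f) (h : ρ ≤ σ) : ExpBounded σ f := by
  obtain ⟨c, hc⟩ := hf
  refine ⟨|c|, fun t ht => (hc t ht).trans ?_⟩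
  have := Real.exp_le_exp.2 (mul_le_mul_of_nonneg_right h ht)
  have h1 := le_abs_self c
  gcongr

theorem add {ρ : ℝ} {f g : ℝ → E} (hf : ExpBounded ρ f) (hg : ExpBounded ρ g) :
    ExpBounded ρ (fun t => f t + g t) := by
  obtain ⟨c, hc⟩ := hf
  obtain ⟨d, hd⟩ := hg
  refine ⟨c + d, fun t ht => (norm_add_le _ _).trans ?_⟩
  rw [add_mul]
  exact add_le_add (hc t ht) (hd t ht)

theorem clm [NormedSpace ℂ E] [NormedSpace ℂ F] {ρ : ℝ} {f : ℝ → E} (hf : ExpBounded ρ f)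
    (T : E →L[ℂ] F) : ExpBounded ρ (fun t => T (f t)) := by
  obtain ⟨c, hc⟩ := hf
  refine ⟨‖T‖ * c, fun t ht => (T.le_opNorm _).trans ?_⟩
  rw [mul_assoc]
  exact mul_le_mul_of_nonneg_left (hc t ht) (norm_nonneg _)

/-- Solutions of a scalar-coefficient equation inherit the growth rate of the forcing term. -/
theorem of_hasDerivAt_smul [NormedSpace ℂ E] {ρ : ℝ} {μ : ℂ} (hμ : μ.re < ρ) {w h : ℝ → E}
    (hh : ExpBounded ρ h) (hw : ∀ t : ℝ, 0 ≤ t → HasDerivAt w (μ • w t + h t) t) :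
    ExpBounded ρ w := by
  obtain ⟨c, hc⟩ := hh
  have hδ : 0 < ρ - μ.re := sub_pos.2 hμ
  have hexp : ∀ t : ℝ, HasDerivAt (fun s : ℝ => Complex.exp (-μ * s))
      (-μ * Complex.exp (-μ * t)) t := fun t => by
    have h1 : HasDerivAt (fun s : ℝ => -μ * (s : ℂ)) (-μ) t := by
      simpa using (Complex.ofRealCLM.hasDerivAt (x := t)).const_mul (-μ)
    simpa [mul_comm] using h1.cexp
  have hu : ∀ t : ℝ, 0 ≤ t → HasDerivAt (fun s : ℝ => Complex.exp (-μ * s) • w s)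
      (Complex.exp (-μ * t) • h t) t := fun t ht => by
    refine ((hexp t).smul (hw t ht)).congr_deriv ?_
    module
  have hnorm : ∀ t : ℝ, ‖Complex.exp (-μ * t)‖ = Real.exp (-μ.re * t) := fun t => by
    simp [Complex.norm_exp]
  have hc0 : 0 ≤ c := by
    have := (norm_nonneg _).trans (hc 0 le_rfl)
    simpa using this
  refine ⟨‖w 0‖ + c / (ρ - μ.re), fun t ht => ?_⟩
  have hB : ∀ x : ℝ, HasDerivAt
      (fun s : ℝ => ‖w 0‖ + c / (ρ - μ.re) * Real.exp ((ρ - μ.re) * s))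
      (c * Real.exp ((ρ - μ.re) * x)) x := fun x => by
    have h1 : HasDerivAt (fun s : ℝ => (ρ - μ.re) * s) (ρ - μ.re) x := by
      simpa using (hasDerivAt_id x).const_mul (ρ - μ.re)
    refine ((h1.exp.const_mul (c / (ρ - μ.re))).const_add ‖w 0‖).congr_deriv ?_
    field_simp
  have key := image_norm_le_of_norm_deriv_right_le_deriv_boundary
    (f := fun s : ℝ => Complex.exp (-μ * s) • w s) (a := 0) (b := t)
    (f' := fun s : ℝ => Complex.exp (-μ * s) • h s)
    (B := fun s : ℝ => ‖w 0‖ + c / (ρ - μ.re) * Real.exp ((ρ - μ.re) * s))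
    (B' := fun s : ℝ => c * Real.exp ((ρ - μ.re) * s))
    (fun s hs => (hu s hs.1).continuousAt.continuousWithinAt)
    (fun s hs => (hu s hs.1).hasDerivWithinAt)
    (by simpa using by positivity)
    hB
    (fun s hs => by
      rw [norm_smul, hnorm]
      calc _ ≤ Real.exp (-μ.re * s) * (c * Real.exp (ρ * s)) :=
            mul_le_mul_of_nonneg_left (hc s hs.1) (Real.exp_pos _).le
        _ = c * (Real.exp (-μ.re * s) * Real.exp (ρ * s)) := by ring
        _ = _ := by rw [← Real.exp_add]; ring_nf)
    ⟨ht, le_rfl⟩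
  simp only [norm_smul, hnorm] at key
  have e1 : Real.exp (μ.re * t) * Real.exp (-μ.re * t) = 1 := by
    rw [← Real.exp_add]; simp
  have e2 : Real.exp (μ.re * t) * Real.exp ((ρ - μ.re) * t) = Real.exp (ρ * t) := by
    rw [← Real.exp_add]; ring_nf
  have e3 : Real.exp (μ.re * t) ≤ Real.exp (ρ * t) :=
    Real.exp_le_exp.2 (mul_le_mul_of_nonneg_right hμ.le ht)
  calc ‖w t‖ = Real.exp (μ.re * t) * (Real.exp (-μ.re * t) * ‖w t‖) := by
        rw [← mul_assoc, e1, one_mul]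
    _ ≤ Real.exp (μ.re * t) *
        (‖w 0‖ + c / (ρ - μ.re) * Real.exp ((ρ - μ.re) * t)) := by gcongr
    _ = Real.exp (μ.re * t) * ‖w 0‖ + c / (ρ - μ.re) * Real.exp (ρ * t) := by
        rw [← e2]; ring
    _ ≤ Real.exp (ρ * t) * ‖w 0‖ + c / (ρ - μ.re) * Real.exp (ρ * t) := by gcongr
    _ = _ := by ring

variable [NormedSpace ℂ E] [FiniteDimensional ℂ E]

open Polynomial in
theorem of_aeval_prod_eq_zero {ρ : ℝ} (T : Module.End ℂ E) (s : Multiset ℂ)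
    (hs : ∀ μ ∈ s, μ.re < ρ) {z g : ℝ → E} (hg : ExpBounded ρ g)
    (hz : ∀ t : ℝ, 0 ≤ t → HasDerivAt z (T (z t) + g t) t)
    (h0 : ∀ t : ℝ, 0 ≤ t → aeval T (s.map fun μ => X - C μ).prod (z t) = 0) :
    ExpBounded ρ z := by
  induction s using Multiset.induction_on generalizing z g with
  | empty => exact ⟨0, fun t ht => by simpa using h0 t ht⟩
  | cons μ s ih =>
    let N : E →L[ℂ] E := LinearMap.toContinuousLinearMap (T - μ • (1 : Module.End ℂ E))
    have hN : ∀ x, N x = T x - μ • x := fun x => by simp [N]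
    have hz₁ : ExpBounded ρ (fun t => N (z t)) := by
      refine ih (fun ν hν => hs ν (Multiset.mem_cons_of_mem hν)) (hg.clm N) (fun t ht => ?_)
        (fun t ht => ?_)
      · refine ((N.restrictScalars ℝ).hasFDerivAt.comp_hasDerivAt t (hz t ht)).congr_deriv ?_
        simp only [ContinuousLinearMap.coe_restrictScalars', hN, map_add, map_sub, map_smul]
      · have := h0 t ht
        rw [Multiset.map_cons, Multiset.prod_cons, mul_comm, map_mul, Module.End.mul_apply] at this
        rw [hN]
        simpa [Algebra.algebraMap_eq_smul_one] using this
    refine of_hasDerivAt_smul (hs μ (Multiset.mem_cons_self _ _)) (hz₁.add hg) fun t ht => ?_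
    refine (hz t ht).congr_deriv ?_
    rw [hN]
    abel

/-- Solutions of `z' = T z + g` grow at most at the rate of `g`, if this rate exceeds the real
parts of all eigenvalues of `T`. -/
theorem of_hasDerivAt {ρ : ℝ} (T : Module.End ℂ E)
    (hT : ∀ μ : ℂ, T.HasEigenvalue μ → μ.re < ρ) {z g : ℝ → E} (hg : ExpBounded ρ g)
    (hz : ∀ t : ℝ, 0 ≤ t → HasDerivAt z (T (z t) + g t) t) : ExpBounded ρ z := by
  refine of_aeval_prod_eq_zero T (minpoly ℂ T).roots (fun μ hμ => hT μ ?_) hg hz fun t _ => ?_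
  · exact Module.End.hasEigenvalue_of_isRoot (Polynomial.isRoot_of_mem_roots hμ)
  · have hp := (IsAlgClosed.splits (minpoly ℂ T)).eq_prod_roots_of_monic
      (minpoly.monic (Algebra.IsIntegral.isIntegral T))
    rw [← hp, minpoly.aeval, LinearMap.zero_apply]

end ExpBounded

theorem Matrix.norm_mulVec_le_card_mul {ι : Type*} [Fintype ι] {M : Matrix ι ι ℝ} {b : ℝ}
    (hM : ∀ i j, |M i j| ≤ b) (hb : 0 ≤ b) (v : ι → ℝ) :
    ‖M *ᵥ v‖ ≤ Fintype.card ι * b * ‖v‖ := by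
  refine (pi_norm_le_iff_of_nonneg (by positivity)).2 fun i => ?_
  calc ‖(M *ᵥ v) i‖ ≤ ∑ j, ‖M i j * v j‖ := norm_sum_le _ _
    _ ≤ ∑ _j : ι, b * ‖v‖ := Finset.sum_le_sum fun j _ => by
        rw [norm_mul]
        exact mul_le_mul (hM i j) (norm_le_pi_norm v j) (norm_nonneg _) hb
    _ = _ := by simp [mul_assoc]

theorem Matrix.charpoly_isRoot_of_mulVec_eq_smul {ι : Type*} [Fintype ι] [DecidableEq ι]
    {M : Matrix ι ι ℂ} {μ : ℂ} {v : ι → ℂ} (hv : v ≠ 0) (h : M *ᵥ v = μ • v) :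
    M.charpoly.IsRoot μ := by
  have : Module.End.HasEigenvalue (toLin' M) μ :=
    Module.End.hasEigenvalue_of_hasEigenvector (x := v)
      ⟨Module.End.mem_eigenspace_iff.2 (by simpa using h), hv⟩
  rw [← Matrix.charpoly_toLin']
  exact (Module.End.hasEigenvalue_iff_isRoot_charpoly _ _).1 this

/-- Every eigenvalue of `I ⊗ S - β (L ⊗ I)` is `σ - β * l` with eigenvalues `σ` of `S` and
`l` of `L`. -/
theorem Matrix.exists_isRoot_of_hasEigenvalue_kronecker {m k : Type*} [Fintype m] [Fintype k]
    [DecidableEq m] [DecidableEq k] (S : Matrix k k ℂ) (L : Matrix m m ℂ) (β : ℂ) {μ : ℂ}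
    (hμ : Module.End.HasEigenvalue
      (toLin' ((1 : Matrix m m ℂ) ⊗ₖ S - β • (L ⊗ₖ (1 : Matrix k k ℂ)))) μ) :
    ∃ σ l : ℂ, S.charpoly.IsRoot σ ∧ L.charpoly.IsRoot l ∧ μ = σ - β * l := by
  set P : Matrix (m × k) (m × k) ℂ := (1 : Matrix m m ℂ) ⊗ₖ S
  set Q : Matrix (m × k) (m × k) ℂ := L ⊗ₖ (1 : Matrix k k ℂ)
  have hPQ : P * Q = Q * P := by simp [P, Q, ← Matrix.mul_kronecker_mul]
  have hinv : ∀ x ∈ Module.End.eigenspace (toLin' (P - β • Q)) μ,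
      toLin' Q x ∈ Module.End.eigenspace (toLin' (P - β • Q)) μ := by
    intro x hx
    rw [Module.End.mem_eigenspace_iff] at hx ⊢
    rw [← map_smul, ← hx]
    simp [Matrix.mulVec_sub, Matrix.mulVec_smul, hPQ]
  have : Nontrivial (Module.End.eigenspace (toLin' (P - β • Q)) μ) :=
    Submodule.nontrivial_iff_ne_bot.2 hμ
  obtain ⟨l, hl⟩ := Module.End.exists_eigenvalue ((toLin' Q).restrict hinv)
  obtain ⟨⟨v, hvmem⟩, hv⟩ := hl.exists_hasEigenvector
  have hv0 : v ≠ 0 := fun h => hv.2 (Subtype.ext h)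
  have hQv : Q *ᵥ v = l • v := by
    simpa using congrArg Subtype.val hv.apply_eq_smul
  have hAv : P *ᵥ v - β • Q *ᵥ v = μ • v := by
    simpa [Matrix.sub_mulVec, Matrix.smul_mulVec] using Module.End.mem_eigenspace_iff.1 hvmem
  have hPv : P *ᵥ v = (μ + β * l) • v := by
    rw [sub_eq_iff_eq_add.1 hAv, hQv]
    module
  obtain ⟨⟨i, j⟩, hij⟩ := Function.ne_iff.1 hv0
  refine ⟨μ + β * l, l, ?_, ?_, by ring⟩
  · refine charpoly_isRoot_of_mulVec_eq_smul (v := fun b => v (i, b))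
      (fun h => hij (congrFun h j)) ?_
    ext b
    have := congrFun hPv (i, b)
    simpa [P, mulVec, dotProduct, Fintype.sum_prod_type, Matrix.one_apply] using this
  · refine charpoly_isRoot_of_mulVec_eq_smul (v := fun a => v (a, j))
      (fun h => hij (congrFun h i)) ?_
    ext a
    have := congrFun hQv (a, j)
    simpa [Q, mulVec, dotProduct, Fintype.sum_prod_type, Matrix.one_apply] using this

namespace ExpBounded

variable {ι : Type*} [Fintype ι]

/-- The real version of `ExpBounded.of_hasDerivAt`, for systems given by a matrix. -/
theorem of_hasDerivAt_mulVec [DecidableEq ι] {ρ : ℝ} (A : Matrix ι ι ℝ)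
    (hA : ∀ μ : ℂ, Module.End.HasEigenvalue (toLin' (A.map Complex.ofReal)) μ → μ.re < ρ)
    {z g : ℝ → ι → ℝ} (hg : ExpBounded ρ g)
    (hz : ∀ t : ℝ, 0 ≤ t → HasDerivAt z (A *ᵥ z t + g t) t) : ExpBounded ρ z := by
  have hnorm : ∀ v : ι → ℝ, ‖fun i => (v i : ℂ)‖ = ‖v‖ := fun v => by
    simp [Pi.norm_def, nnnorm, Complex.norm_real]
  have hg' : ExpBounded ρ (fun t i => (g t i : ℂ)) := by
    simpa only [ExpBounded, hnorm] using hg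
  have := of_hasDerivAt (z := fun t i => (z t i : ℂ)) (toLin' (A.map Complex.ofReal)) hA hg'
    fun t ht => by
      refine hasDerivAt_pi.2 fun i => ?_
      refine (hasDerivAt_pi.1 (hz t ht) i).ofReal_comp.congr_deriv ?_
      simp [mulVec, dotProduct]
  simpa only [ExpBounded, hnorm] using this

theorem mulVec {ρ α c : ℝ} (hc : 0 ≤ c) {M : ℝ → Matrix ι ι ℝ}
    (hM : ∀ t : ℝ, 0 ≤ t → ∀ i j, |M t i j| ≤ c * Real.exp (-α * t))
    {f : ℝ → ι → ℝ} (hf : ExpBounded ρ f) : ExpBounded (ρ - α) (fun t => M t *ᵥ f t) := by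
  obtain ⟨d, hd⟩ := hf
  refine ⟨Fintype.card ι * c * d, fun t ht => ?_⟩
  calc ‖M t *ᵥ f t‖ ≤ Fintype.card ι * (c * Real.exp (-α * t)) * ‖f t‖ :=
        norm_mulVec_le_card_mul (hM t ht) (by positivity) _
    _ ≤ Fintype.card ι * (c * Real.exp (-α * t)) * (d * Real.exp (ρ * t)) := by
        gcongr
        exact hd t ht
    _ = Fintype.card ι * c * d * (Real.exp (ρ * t) * Real.exp (-α * t)) := by ring
    _ = _ := by rw [← Real.exp_add]; ring_nf

/-- Grönwall's inequality as an a priori exponential bound. -/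
theorem of_norm_deriv_le {E : Type*} [NormedAddCommGroup E] [NormedSpace ℝ E] {K ε : ℝ}
    (hK : 0 < K) (hε : 0 ≤ ε) {f f' : ℝ → E} (hf : ∀ t : ℝ, 0 ≤ t → HasDerivAt f (f' t) t)
    (hf' : ∀ t : ℝ, 0 ≤ t → ‖f' t‖ ≤ K * ‖f t‖ + ε) : ExpBounded K f := by
  refine ⟨‖f 0‖ + ε / K, fun t ht => ?_⟩
  have h := norm_le_gronwallBound_of_norm_deriv_right_le (f := f) (f' := f') (a := 0) (b := t)
    (fun s hs => (hf s hs.1).continuousAt.continuousWithinAt)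
    (fun s hs => (hf s hs.1).hasDerivWithinAt) le_rfl (fun s hs => hf' s hs.1) t ⟨ht, le_rfl⟩
  rw [gronwallBound_of_K_ne_0 hK.ne', sub_zero] at h
  have : 0 ≤ ε / K := by positivity
  linarith

end ExpBounded

theorem Module.End.exists_pos_re_lt_neg {E : Type*} [NormedAddCommGroup E] [NormedSpace ℂ E]
    [FiniteDimensional ℂ E] (T : Module.End ℂ E) (hT : ∀ μ : ℂ, T.HasEigenvalue μ → μ.re < 0)
    {α : ℝ} (hα : 0 < α) : ∃ σ : ℝ, 0 < σ ∧ σ < α ∧ ∀ μ : ℂ, T.HasEigenvalue μ → μ.re < -σ := by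
  have hfin : {μ : ℂ | T.HasEigenvalue μ}.Finite := T.finite_hasEigenvalue
  have h1 : ∀ᶠ σ : ℝ in nhdsWithin 0 (Set.Ioi 0), ∀ μ ∈ {μ : ℂ | T.HasEigenvalue μ},
      σ < -μ.re :=
    (Filter.eventually_all_finite hfin).2 fun μ hμ =>
      nhdsWithin_le_nhds (eventually_lt_nhds (neg_pos.2 (hT μ hμ)))
  obtain ⟨σ, ⟨h, hσα⟩, hσ⟩ :=
    ((h1.and (nhdsWithin_le_nhds (eventually_lt_nhds hα))).and self_mem_nhdsWithin).exists
  exact ⟨σ, hσ, hσα, fun μ hμ => by linarith [h μ hμ]⟩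

/-- **Convergence of the adaptive observer error (45) (part of Theorem 2).** If every
complex eigenvalue of `S` has nonpositive real part, every complex eigenvalue of `L₁` has
positive real part, `β₂ > 0`, `S̃_d(t)` is continuous and decays to zero exponentially,
and `ω*(t)` is continuous and bounded, then every solution of
`η̃' = ((Iₙ ⊗ S) − β₂(L₁ ⊗ I_q̄))η̃ + S̃_d(t)η̃ + S̃_d(t)ω*(t)` (for `t ≥ 0`) decays to
zero exponentially. -/
theorem adaptive_observer_error_exp_decay (n qb : ℕ)
    (S : Matrix (Fin qb) (Fin qb) ℝ)
    (hS : ∀ μ : ℂ, (S.map Complex.ofReal).charpoly.IsRoot μ → μ.re ≤ 0)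
    (L₁ : Matrix (Fin n) (Fin n) ℝ)
    (hL₁ : ∀ μ : ℂ, (L₁.map Complex.ofReal).charpoly.IsRoot μ → 0 < μ.re)
    (β₂ : ℝ) (hβ₂ : 0 < β₂)
    (Sd : ℝ → Matrix (Fin n × Fin qb) (Fin n × Fin qb) ℝ)
    (hSdcont : Continuous Sd)
    (hSddecay : ∃ c > (0 : ℝ), ∃ α > (0 : ℝ), ∀ t : ℝ, 0 ≤ t →
      ∀ i j, |Sd t i j| ≤ c * Real.exp (-α * t))
    (ωs : ℝ → (Fin n × Fin qb → ℝ))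
    (hωcont : Continuous ωs) (hωbdd : ∃ c : ℝ, ∀ t : ℝ, ‖ωs t‖ ≤ c)
    (η : ℝ → (Fin n × Fin qb → ℝ)) (hη : Differentiable ℝ η)
    (hode : ∀ t : ℝ, 0 ≤ t → HasDerivAt η
      (((((1 : Matrix (Fin n) (Fin n) ℝ) ⊗ₖ S) -
          β₂ • (L₁ ⊗ₖ (1 : Matrix (Fin qb) (Fin qb) ℝ))).mulVec (η t)) +
        (Sd t).mulVec (η t) + (Sd t).mulVec (ωs t)) t) :
    ∃ c > (0 : ℝ), ∃ α > (0 : ℝ), ∀ t : ℝ, 0 ≤ t →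
      ‖η t‖ ≤ c * Real.exp (-α * t) := by
  obtain ⟨c, hc, α, hα, hSd⟩ := hSddecay
  set A : Matrix (Fin n × Fin qb) (Fin n × Fin qb) ℝ :=
    ((1 : Matrix (Fin n) (Fin n) ℝ) ⊗ₖ S) -
      β₂ • (L₁ ⊗ₖ (1 : Matrix (Fin qb) (Fin qb) ℝ)) with hA
  have hAmap : A.map Complex.ofReal = (1 : Matrix (Fin n) (Fin n) ℂ) ⊗ₖ S.map Complex.ofReal -
      (β₂ : ℂ) • (L₁.map Complex.ofReal ⊗ₖ (1 : Matrix (Fin qb) (Fin qb) ℂ)) := by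
    ext ⟨i, j⟩ ⟨k, l⟩
    simp [hA, Matrix.one_apply, apply_ite Complex.ofReal]
  have hneg : ∀ μ : ℂ, Module.End.HasEigenvalue (toLin' (A.map Complex.ofReal)) μ →
      μ.re < 0 := fun μ hμ => by
    rw [hAmap] at hμ
    obtain ⟨σ, l, hσ, hl, rfl⟩ := exists_isRoot_of_hasEigenvalue_kronecker _ _ _ hμ
    have h1 := hS σ hσ
    have h2 := mul_pos hβ₂ (hL₁ l hl)
    simp only [Complex.sub_re, Complex.re_ofReal_mul]
    linarith
  obtain ⟨σ, hσ, hσα, hgap⟩ := Module.End.exists_pos_re_lt_neg _ hneg hα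
  obtain ⟨w, hw⟩ := hωbdd
  have hω : ExpBounded 0 ωs := ⟨w, fun t _ => by simpa using hw t⟩
  have hw0 : 0 ≤ w := (norm_nonneg _).trans (hw 0)
  have hSω : ExpBounded (-α) (fun t => Sd t *ᵥ ωs t) := by
    simpa using hω.mulVec hc.le hSd
  have hstep : ∀ ρ : ℝ, ExpBounded ρ η → ExpBounded (max (ρ - α) (-σ)) η := fun ρ hρ => by
    refine .of_hasDerivAt_mulVec A (fun μ hμ => (hgap μ hμ).trans_le (le_max_right _ _))
      (((hρ.mulVec hc.le hSd).mono (le_max_left _ _)).add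
        (hSω.mono ((neg_le_neg hσα.le).trans (le_max_right _ _)))) fun t ht => ?_
    simpa only [add_assoc] using hode t ht
  obtain ⟨K, hK⟩ : ∃ K : ℝ, ExpBounded K η := by
    let N : ℝ := Fintype.card (Fin n × Fin qb)
    let a : ℝ := ∑ i, ∑ j, |A i j|
    have hN : 0 ≤ N := Nat.cast_nonneg _
    have ha : 0 ≤ a := by positivity
    have haA : ∀ i j, |A i j| ≤ a := fun i j =>
      (Finset.single_le_sum (f := fun j => |A i j|) (fun _ _ => abs_nonneg _)
        (Finset.mem_univ j)).trans
      (Finset.single_le_sum (f := fun i => ∑ j, |A i j|)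
        (fun _ _ => Finset.sum_nonneg fun _ _ => abs_nonneg _) (Finset.mem_univ i))
    refine ⟨N * a + N * c + 1, .of_norm_deriv_le (ε := N * c * w) (by positivity)
      (by positivity) hode fun t ht => ?_⟩
    have hSdc : ∀ i j, |Sd t i j| ≤ c := fun i j => (hSd t ht i j).trans <|
      mul_le_of_le_one_right hc.le (Real.exp_le_one_iff.2 (by nlinarith))
    have h1 : ‖A *ᵥ η t‖ ≤ N * a * ‖η t‖ := norm_mulVec_le_card_mul haA ha _
    have h2 : ‖Sd t *ᵥ η t‖ ≤ N * c * ‖η t‖ := norm_mulVec_le_card_mul hSdc hc.le _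
    have h3 : ‖Sd t *ᵥ ωs t‖ ≤ N * c * w := (norm_mulVec_le_card_mul hSdc hc.le _).trans
      (mul_le_mul_of_nonneg_left (hw t) (by positivity))
    have h4 := norm_add₃_le (a := A *ᵥ η t) (b := Sd t *ᵥ η t) (c := Sd t *ᵥ ωs t)
    linarith [norm_nonneg (η t)]
  have hiter : ∀ k : ℕ, ExpBounded (max (K - k * α) (-σ)) η := fun k => by
    induction k with
    | zero => exact hK.mono (by simp)
    | succ k ih =>
      refine (hstep _ ih).mono (max_le ?_ (le_max_right _ _))
      rw [sub_le_iff_le_add, max_le_iff, ← sub_le_iff_le_add, ← sub_le_iff_le_add]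
      push_cast
      exact ⟨le_max_of_le_left (by linarith), le_max_of_le_right (by linarith)⟩
  obtain ⟨k, hk⟩ := exists_nat_ge ((K + σ) / α)
  have hkα : K + σ ≤ k * α := (div_le_iff₀ hα).1 hk
  obtain ⟨d, hd⟩ := (hiter k).mono (max_le (by linarith) le_rfl : _ ≤ -σ)
  refine ⟨|d| + 1, by positivity, σ, hσ, fun t ht => (hd t ht).trans ?_⟩
  have := le_abs_self d
  gcongr
  linarith
end

section
/- Let P ∈ ℝ^{s×s}, B ∈ ℝ^{s×p}, C ∈ ℝ^{r×s}, let Q ∈ ℝ^{r×r} and W ∈ ℝ^{p×p} be symmetric positive definite, and let γ ∈ ℝ. Suppose Ψ ∈ ℝ^{s×s} is symmetric positive semidefinite and satisfies the discounted algebraic Riccati equation PᵀΨ + ΨP − γΨ + CᵀQC − ΨBW⁻¹BᵀΨ = 0. Then the null space of Ψ is contained in the null space of C: for every x ∈ ℝ^s, Ψx = 0 implies Cx = 0. -/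
open Matrix

/-- **Null-space property of the discounted ARE solution (proof of Lemma 5).** If `Ψ` is a
symmetric positive semidefinite solution of the discounted algebraic Riccati equation
`PᵀΨ + ΨP − γΨ + CᵀQC − ΨBW⁻¹BᵀΨ = 0` with `Q` and `W` symmetric positive definite, then
the null space of `Ψ` is contained in the null space of `C`. -/
theorem discounted_are_null_space (s p r : ℕ)
    (P : Matrix (Fin s) (Fin s) ℝ) (B : Matrix (Fin s) (Fin p) ℝ)
    (C : Matrix (Fin r) (Fin s) ℝ)
    (Q : Matrix (Fin r) (Fin r) ℝ) (W : Matrix (Fin p) (Fin p) ℝ)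
    (hQ : Q.PosDef) (hW : W.PosDef)
    (γ : ℝ)
    (Ψ : Matrix (Fin s) (Fin s) ℝ) (hΨ : Ψ.PosSemidef)
    (hare : Pᵀ * Ψ + Ψ * P - γ • Ψ + Cᵀ * Q * C - Ψ * B * W⁻¹ * Bᵀ * Ψ = 0) :
    ∀ x : Fin s → ℝ, Ψ.mulVec x = 0 → C.mulVec x = 0 := by
  intro x hx
  have hx' : x ᵥ* Ψ = 0 := by
    have hsymm : Ψᵀ = Ψ := by simpa using hΨ.isHermitian.eq
    rw [← hsymm, vecMul_transpose, hx]
  have hquad : C *ᵥ x ⬝ᵥ Q *ᵥ (C *ᵥ x) = 0 := by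
    have h := congrArg (fun M => x ⬝ᵥ M *ᵥ x) hare
    simpa [add_mulVec, sub_mulVec, smul_mulVec, ← mulVec_mulVec, dotProduct_mulVec x Ψ, hx, hx',
      dotProduct_mulVec x Cᵀ, vecMul_transpose] using h
  by_contra hne
  exact (hQ.dotProduct_mulVec_pos hne).ne' (by simpa using hquad)
end

section
/- Let P ∈ ℝ^{s×s}, B ∈ ℝ^{s×p}, C ∈ ℝ^{r×s}, Q ∈ ℝ^{r×r}, let W ∈ ℝ^{p×p} be symmetric and invertible, γ ∈ ℝ, and K ∈ ℝ^{p×s}. Suppose Ψ ∈ ℝ^{s×s} is symmetric and satisfies the policy-evaluation equation Ψ(P + BK) + (P + BK)ᵀΨ = γΨ − CᵀQC − KᵀWK, and define K' = −W⁻¹BᵀΨ. Then for any differentiable x : ℝ → ℝ^s and any u : ℝ → ℝ^p with x'(t) = Px(t) + Bu(t) for all t, the value function V(t) = x(t)ᵀΨx(t) satisfies the off-policy differential Bellman identity V'(t) = γV(t) − x(t)ᵀCᵀQCx(t) − (Kx(t))ᵀW(Kx(t)) − 2(K'x(t))ᵀW(u(t) − Kx(t)). -/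
open Matrix

/-- The product rule for the dot product of two differentiable vector-valued curves. -/
theorem hasDerivAt_dotProduct {n : Type*} [Fintype n] {f g : ℝ → n → ℝ} {f' g' : n → ℝ} {t : ℝ}
    (hf : HasDerivAt f f' t) (hg : HasDerivAt g g' t) :
    HasDerivAt (fun τ => f τ ⬝ᵥ g τ) (f' ⬝ᵥ g t + f t ⬝ᵥ g') t := by
  rw [hasDerivAt_pi] at hf hg
  simp only [dotProduct, ← Finset.sum_add_distrib]
  exact HasDerivAt.fun_sum fun i _ => (hf i).mul (hg i)

/-- Applying a constant matrix to a differentiable curve commutes with differentiation. -/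
theorem hasDerivAt_mulVec {m n : Type*} [Fintype m] [Fintype n] (A : Matrix m n ℝ)
    {f : ℝ → n → ℝ} {f' : n → ℝ} {t : ℝ} (hf : HasDerivAt f f' t) :
    HasDerivAt (fun τ => A *ᵥ f τ) (A *ᵥ f') t := by
  rw [hasDerivAt_pi]
  intro i
  simpa [mulVec] using hasDerivAt_dotProduct (hasDerivAt_const t (A i)) hf

/-- Moving a matrix from the left to the right argument of the dot product. -/
theorem mulVec_dotProduct_eq {m n : Type*} [Fintype m] [Fintype n] (A : Matrix m n ℝ)
    (v : n → ℝ) (w : m → ℝ) : A *ᵥ v ⬝ᵥ w = v ⬝ᵥ Aᵀ *ᵥ w := by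
  rw [dotProduct_mulVec, vecMul_transpose]

/-- **Off-policy differential Bellman identity (82).** If `Ψ` is a symmetric solution of
the policy-evaluation equation `Ψ(P + BK) + (P + BK)ᵀΨ = γΨ − CᵀQC − KᵀWK` and
`K' = −W⁻¹BᵀΨ`, then along any trajectory of `x' = Px + Bu` the value function
`V(t) = x(t)ᵀΨx(t)` satisfies
`V' = γV − xᵀCᵀQCx − (Kx)ᵀW(Kx) − 2(K'x)ᵀW(u − Kx)`. -/
theorem off_policy_differential_bellman (s p r : ℕ)
    (P : Matrix (Fin s) (Fin s) ℝ) (B : Matrix (Fin s) (Fin p) ℝ)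
    (C : Matrix (Fin r) (Fin s) ℝ) (Q : Matrix (Fin r) (Fin r) ℝ)
    (W : Matrix (Fin p) (Fin p) ℝ) (hWsymm : Wᵀ = W) (hWinv : IsUnit W.det)
    (γ : ℝ) (K : Matrix (Fin p) (Fin s) ℝ)
    (Ψ : Matrix (Fin s) (Fin s) ℝ) (hΨsymm : Ψᵀ = Ψ)
    (hpe : Ψ * (P + B * K) + (P + B * K)ᵀ * Ψ = γ • Ψ - Cᵀ * Q * C - Kᵀ * W * K)
    (K' : Matrix (Fin p) (Fin s) ℝ) (hK' : K' = -(W⁻¹ * Bᵀ * Ψ))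
    (x : ℝ → Fin s → ℝ) (u : ℝ → Fin p → ℝ)
    (hx : Differentiable ℝ x)
    (hode : ∀ t : ℝ, HasDerivAt x (P.mulVec (x t) + B.mulVec (u t)) t) :
    ∀ t : ℝ, HasDerivAt (fun τ => x τ ⬝ᵥ Ψ.mulVec (x τ))
      (γ * (x t ⬝ᵥ Ψ.mulVec (x t))
        - C.mulVec (x t) ⬝ᵥ Q.mulVec (C.mulVec (x t))
        - K.mulVec (x t) ⬝ᵥ W.mulVec (K.mulVec (x t))
        - 2 * (K'.mulVec (x t) ⬝ᵥ W.mulVec (u t - K.mulVec (x t)))) t := by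
  intro t
  convert hasDerivAt_dotProduct (hode t) (hasDerivAt_mulVec Ψ (hode t)) using 1
  have hgain : K'ᵀ * W = -(Ψ * B) := by
    rw [hK', transpose_neg, transpose_mul, transpose_mul, transpose_transpose,
      transpose_nonsing_inv, hWsymm, hΨsymm, Matrix.neg_mul, ← Matrix.mul_assoc,
      nonsing_inv_mul_cancel_right _ _ hWinv]
  have hgain_quad : K' *ᵥ x t ⬝ᵥ W *ᵥ (u t - K *ᵥ x t)
      = -(x t ⬝ᵥ Ψ *ᵥ B *ᵥ (u t - K *ᵥ x t)) := by
    rw [mulVec_dotProduct_eq, mulVec_mulVec, hgain, neg_mulVec, dotProduct_neg, mulVec_mulVec]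
  have hpe_quad := congrArg (fun M => x t ⬝ᵥ M *ᵥ x t) hpe
  have hswap : ∀ a b : Fin s → ℝ, a ⬝ᵥ Ψ *ᵥ b = b ⬝ᵥ Ψ *ᵥ a := fun a b => by
    rw [dotProduct_comm, mulVec_dotProduct_eq, hΨsymm]
  simp only [add_mulVec, sub_mulVec, smul_mulVec, ← mulVec_mulVec, dotProduct_add,
    dotProduct_sub, dotProduct_smul, ← mulVec_dotProduct_eq, smul_eq_mul, mulVec_add,
    add_dotProduct] at hpe_quad
  rw [hgain_quad]
  simp only [mulVec_add, mulVec_sub, dotProduct_add, dotProduct_sub, add_dotProduct]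
  rw [hswap (P *ᵥ x t), hswap (B *ᵥ u t)]
  rw [hswap (P *ᵥ x t), hswap (B *ᵥ K *ᵥ x t)] at hpe_quad
  linarith
end

section
/- Let P ∈ ℝ^{s×s}, B ∈ ℝ^{s×p}, C ∈ ℝ^{r×s}, Q ∈ ℝ^{r×r}, let W ∈ ℝ^{p×p} be symmetric and invertible, γ ∈ ℝ, and K ∈ ℝ^{p×s}. Suppose Ψ ∈ ℝ^{s×s} is symmetric and satisfies Ψ(P + BK) + (P + BK)ᵀΨ = γΨ − CᵀQC − KᵀWK, and define K' = −W⁻¹BᵀΨ. Then for any continuously differentiable x : ℝ → ℝ^s and continuous u : ℝ → ℝ^p with x'(τ) = Px(τ) + Bu(τ) for all τ, and for any t ∈ ℝ and T > 0, the off-policy Bellman equation holds: e^{−γT}·x(t+T)ᵀΨx(t+T) − x(t)ᵀΨx(t) = ∫_t^{t+T} e^{−γ(τ−t)}·(−x(τ)ᵀCᵀQCx(τ) − (Kx(τ))ᵀW(Kx(τ)) − 2(K'x(τ))ᵀW(u(τ) − Kx(τ))) dτ. -/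
open Matrix

/-- The matrix-vector product of a fixed matrix with a differentiable curve. -/
theorem HasDerivAt.matrix_mulVec {m n : Type*} [Fintype m] [Fintype n] (M : Matrix m n ℝ)
    {x : ℝ → n → ℝ} {x' : n → ℝ} {τ : ℝ} (hx : HasDerivAt x x' τ) :
    HasDerivAt (fun y => M *ᵥ x y) (M *ᵥ x') τ :=
  M.mulVecLin.toContinuousLinearMap.hasFDerivAt.comp_hasDerivAt τ hx

/-- The product rule for the dot product of two differentiable curves. -/
theorem HasDerivAt.vec_dotProduct {n : Type*} [Fintype n] {x y : ℝ → n → ℝ} {x' y' : n → ℝ}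
    {τ : ℝ} (hx : HasDerivAt x x' τ) (hy : HasDerivAt y y' τ) :
    HasDerivAt (fun z => x z ⬝ᵥ y z) (x' ⬝ᵥ y τ + x τ ⬝ᵥ y') τ := by
  simp only [dotProduct, ← Finset.sum_add_distrib]
  exact HasDerivAt.fun_sum fun i _ => (hasDerivAt_pi.1 hx i).mul (hasDerivAt_pi.1 hy i)

theorem Matrix.mulVec_dotProduct_eq_transpose {R m n : Type*} [CommSemiring R] [Fintype m]
    [Fintype n] (M : Matrix m n R) (a : n → R) (b : m → R) : M *ᵥ a ⬝ᵥ b = a ⬝ᵥ Mᵀ *ᵥ b := by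
  rw [dotProduct_mulVec, vecMul_transpose]

/-- The infinitesimal form of the off-policy Bellman equation. -/
theorem off_policy_bellman_pointwise {s p r : Type*} [Fintype s] [Fintype p] [Fintype r]
    [DecidableEq p]
    {P : Matrix s s ℝ} {B : Matrix s p ℝ} {C : Matrix r s ℝ} {Q : Matrix r r ℝ}
    {W : Matrix p p ℝ} (hWsymm : Wᵀ = W) (hWinv : IsUnit W.det)
    {γ : ℝ} {K : Matrix p s ℝ} {Ψ : Matrix s s ℝ} (hΨsymm : Ψᵀ = Ψ)
    (hpe : Ψ * (P + B * K) + (P + B * K)ᵀ * Ψ = γ • Ψ - Cᵀ * Q * C - Kᵀ * W * K)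
    (x : s → ℝ) (u : p → ℝ) :
    (P *ᵥ x + B *ᵥ u) ⬝ᵥ Ψ *ᵥ x + x ⬝ᵥ Ψ *ᵥ (P *ᵥ x + B *ᵥ u) - γ * (x ⬝ᵥ Ψ *ᵥ x) =
      -(C *ᵥ x ⬝ᵥ Q *ᵥ (C *ᵥ x)) - K *ᵥ x ⬝ᵥ W *ᵥ (K *ᵥ x)
        - 2 * (-(W⁻¹ * Bᵀ * Ψ) *ᵥ x ⬝ᵥ W *ᵥ (u - K *ᵥ x)) := by
  obtain ⟨v, rfl⟩ : ∃ v, u = v + K *ᵥ x := ⟨u - K *ᵥ x, by simp⟩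
  have hdrift : P *ᵥ x + B *ᵥ (v + K *ᵥ x) = (P + B * K) *ᵥ x + B *ᵥ v := by
    simp only [mulVec_add, add_mulVec, ← mulVec_mulVec]
    abel
  have hgain : (-(W⁻¹ * Bᵀ * Ψ))ᵀ * W = -(Ψ * B) := by
    simp only [transpose_neg, transpose_mul, transpose_transpose, transpose_nonsing_inv, hWsymm,
      hΨsymm, Matrix.neg_mul, Matrix.mul_assoc, nonsing_inv_mul _ hWinv, Matrix.mul_one]
  have hquad := congrArg (fun M => x ⬝ᵥ M *ᵥ x) hpe
  have hcross : B *ᵥ v ⬝ᵥ Ψ *ᵥ x = x ⬝ᵥ (Ψ * B) *ᵥ v := by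
    rw [dotProduct_comm, mulVec_dotProduct_eq_transpose, hΨsymm, mulVec_mulVec]
  simp only [add_mulVec, sub_mulVec, smul_mulVec, dotProduct_add, dotProduct_sub,
    dotProduct_smul, smul_eq_mul, mul_add, Matrix.mul_assoc] at hquad
  rw [hdrift, add_sub_cancel_right, add_dotProduct, hcross]
  generalize -(W⁻¹ * Bᵀ * Ψ) = K' at hgain ⊢
  rw [mulVec_dotProduct_eq_transpose K', mulVec_dotProduct_eq_transpose C,
    mulVec_dotProduct_eq_transpose K, mulVec_dotProduct_eq_transpose (P + B * K)]
  simp only [mulVec_mulVec, mulVec_add, dotProduct_add, hgain, neg_mulVec, dotProduct_neg,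
    add_mulVec]
  linarith

/-- **Off-policy integral Bellman equation (83).** If `Ψ` is a symmetric solution of the
policy-evaluation equation `Ψ(P + BK) + (P + BK)ᵀΨ = γΨ − CᵀQC − KᵀWK` and
`K' = −W⁻¹BᵀΨ`, then along any trajectory of `x' = Px + Bu` (with `u` continuous),
for any `t` and `T > 0`,
`e^{−γT} x(t+T)ᵀΨx(t+T) − x(t)ᵀΨx(t)
  = ∫_t^{t+T} e^{−γ(τ−t)} (−xᵀCᵀQCx − (Kx)ᵀW(Kx) − 2(K'x)ᵀW(u − Kx)) dτ`. -/
theorem off_policy_integral_bellman (s p r : ℕ)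
    (P : Matrix (Fin s) (Fin s) ℝ) (B : Matrix (Fin s) (Fin p) ℝ)
    (C : Matrix (Fin r) (Fin s) ℝ) (Q : Matrix (Fin r) (Fin r) ℝ)
    (W : Matrix (Fin p) (Fin p) ℝ) (hWsymm : Wᵀ = W) (hWinv : IsUnit W.det)
    (γ : ℝ) (K : Matrix (Fin p) (Fin s) ℝ)
    (Ψ : Matrix (Fin s) (Fin s) ℝ) (hΨsymm : Ψᵀ = Ψ)
    (hpe : Ψ * (P + B * K) + (P + B * K)ᵀ * Ψ = γ • Ψ - Cᵀ * Q * C - Kᵀ * W * K)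
    (K' : Matrix (Fin p) (Fin s) ℝ) (hK' : K' = -(W⁻¹ * Bᵀ * Ψ))
    (x : ℝ → Fin s → ℝ) (u : ℝ → Fin p → ℝ)
    (hx : Differentiable ℝ x) (hu : Continuous u)
    (hode : ∀ τ : ℝ, HasDerivAt x (P.mulVec (x τ) + B.mulVec (u τ)) τ)
    (t T : ℝ) (hT : 0 < T) :
    Real.exp (-γ * T) * (x (t + T) ⬝ᵥ Ψ.mulVec (x (t + T))) -
        x t ⬝ᵥ Ψ.mulVec (x t) =
      ∫ τ in t..(t + T), Real.exp (-γ * (τ - t)) *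
        (-(C.mulVec (x τ) ⬝ᵥ Q.mulVec (C.mulVec (x τ)))
          - K.mulVec (x τ) ⬝ᵥ W.mulVec (K.mulVec (x τ))
          - 2 * (K'.mulVec (x τ) ⬝ᵥ W.mulVec (u τ - K.mulVec (x τ)))) := by
  subst hK'
  have hderiv : ∀ τ ∈ Set.uIcc t (t + T), HasDerivAt
      (fun y => Real.exp (-γ * (y - t)) * (x y ⬝ᵥ Ψ *ᵥ x y))
      (Real.exp (-γ * (τ - t)) *
        (-(C *ᵥ x τ ⬝ᵥ Q *ᵥ (C *ᵥ x τ)) - K *ᵥ x τ ⬝ᵥ W *ᵥ (K *ᵥ x τ)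
          - 2 * (-(W⁻¹ * Bᵀ * Ψ) *ᵥ x τ ⬝ᵥ W *ᵥ (u τ - K *ᵥ x τ)))) τ := by
    intro τ _
    have hexp := (((hasDerivAt_id τ).sub_const t).const_mul (-γ)).exp
    refine (hexp.mul ((hode τ).vec_dotProduct ((hode τ).matrix_mulVec Ψ))).congr_deriv ?_
    rw [← off_policy_bellman_pointwise hWsymm hWinv hΨsymm hpe]
    simp only [id]
    ring
  have hxc : Continuous x := hx.continuous
  rw [intervalIntegral.integral_eq_sub_of_hasDerivAt hderiv
    (Continuous.intervalIntegrable (by fun_prop) _ _)]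
  simp
end
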